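/- Let X be a labeled graph all of whose charges are rational. Suppose that if the underlying graph Γ is bipartite, then for every partition V = V₀ ⊔ V₁ witnessing bipartiteness, one of the parts V₀, V₁ contains four distinct vertices with equal nonzero charges. Then every NPC-solution (a,γ) of the BKN-equation over X can be approximated by rational NPC-solutions: for every ε > 0 there is an NPC-solution (a',γ') taking only rational values with |a'_v − a_v| < ε for all v ∈ V and |γ'_w − γ_w| < ε for all w ∈ W. -/

import Mathlib

open Finset Matrix

/-- A labeled graph `X = (Γ, |B|, K)`: a finite connected graph with oriented edge set `W`
(carrying the fixed-point-free orientation-reversal involution `rev` and initial-vertex map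
`ini`), positive integer weights `b` on oriented edges with `b (rev w) = b w`, and real
charges `k` on vertices. -/
structure LabeledGraph (V W : Type) [Fintype V] [DecidableEq V] [Fintype W] [DecidableEq W] where
  rev : W → W
  rev_invol : ∀ w, rev (rev w) = w
  rev_ne : ∀ w, rev w ≠ w
  ini : W → V
  b : W → ℕ
  b_pos : ∀ w, 0 < b w
  b_symm : ∀ w, b (rev w) = b w
  k : V → ℝ
  edges_nonempty : Nonempty W
  connected : ∀ u v : V,
    Relation.ReflTransGen (fun x y => ∃ w, ini w = x ∧ ini (rev w) = y) u v

namespace LabeledGraph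

variable {V W : Type} [Fintype V] [DecidableEq V] [Fintype W] [DecidableEq W]

/-- The terminal vertex `w⁺ = (-w)⁻` of an oriented edge. -/
def ter (X : LabeledGraph V W) (w : W) : V := X.ini (X.rev w)

/-- The BKN-equation over `X`: `k_v · a_v = Σ_{w ∈ ∂v} (γ_w/|b_w|) · a_{w⁺}` for all `v`. -/
def BKN (X : LabeledGraph V W) (a : V → ℝ) (γ : W → ℝ) : Prop :=
  ∀ v : V, X.k v * a v =
    ∑ w ∈ univ.filter (fun w => X.ini w = v), γ w / (X.b w : ℝ) * a (X.ter w)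

/-- Compatibility of a solution `(a,γ)`. -/
def Compatible (X : LabeledGraph V W) (a : V → ℝ) (γ : W → ℝ) : Prop :=
  (∀ v, 0 ≤ a v) ∧ a ≠ 0 ∧ (∀ w, |γ w| ≤ 1) ∧
    (∀ w, |γ w * γ (X.rev w)| = 1 → γ (X.rev w) = γ w) ∧
    (∀ v, a v = 0 → ∀ w, X.ini w = v → γ w = 0 ∧ γ (X.rev w) = 0)

/-- The angle function is symmetric: `γ_{-w} = γ_w`. -/
def SymSol (X : LabeledGraph V W) (γ : W → ℝ) : Prop := ∀ w, γ (X.rev w) = γ w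

/-- An NPC-solution: a compatible symmetric solution with positive length function and
`|γ| < 1`. -/
def NPCSolution (X : LabeledGraph V W) (a : V → ℝ) (γ : W → ℝ) : Prop :=
  X.BKN a γ ∧ X.Compatible a γ ∧ X.SymSol γ ∧ (∀ v, 0 < a v) ∧ ∀ w, |γ w| < 1

/-- The operator `A⁺ = D⁺ − J` on `ℝ^V`. -/
noncomputable def Aplus (X : LabeledGraph V W) : Matrix V V ℝ :=
  Matrix.of fun v v' =>
    (if v = v' then |X.k v| else 0)
      - ∑ w ∈ univ.filter (fun w => X.ini w = v ∧ X.ter w = v'), (1 : ℝ) / (X.b w)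

/-- The operator `A_λ = D − J_λ` on `ℝ^V` for a (symmetric `±1`-valued) function `λ` on `W`. -/
noncomputable def Aop (X : LabeledGraph V W) (lam : W → ℝ) : Matrix V V ℝ :=
  Matrix.of fun v v' =>
    (if v = v' then X.k v else 0)
      - ∑ w ∈ univ.filter (fun w => X.ini w = v ∧ X.ter w = v'), lam w / (X.b w : ℝ)

/-- Two vertices lie in the same sign component. -/
def SameSign (X : LabeledGraph V W) : V → V → Prop :=
  Relation.ReflTransGen fun x y =>
    (∃ w, X.ini w = x ∧ X.ter w = y) ∧ 0 < X.k x * X.k y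

/-- A `±1`-valued sign function `s` of type (ii): constant on sign components, alternating
along edges joining distinct sign components, and equal to `1` at some vertex of positive
charge. -/
def TypeII (X : LabeledGraph V W) (s : V → ℝ) : Prop :=
  (∀ v, s v = 1 ∨ s v = -1) ∧
    (∀ u v, X.SameSign u v → s u = s v) ∧
    (∀ w, ¬ X.SameSign (X.ini w) (X.ter w) → s (X.ini w) = - s (X.ter w)) ∧
    (∃ v, s v = 1 ∧ 0 < X.k v)

/-- An admissible sign function: of type (ii), or identically zero when no type (ii)
function exists. -/
def Admissible (X : LabeledGraph V W) (s : V → ℝ) : Prop :=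
  X.TypeII s ∨ (s = 0 ∧ ¬ ∃ s', X.TypeII s')

open scoped Classical in
/-- The operator `H = D_s − J₀` associated with an admissible sign function `s`; only
oriented edges with both endpoints in one and the same sign component contribute. -/
noncomputable def Hop (X : LabeledGraph V W) (s : V → ℝ) : Matrix V V ℝ :=
  Matrix.of fun v v' =>
    (if v = v' then s v * X.k v else 0)
      - ∑ w ∈ univ.filter
          (fun w => X.ini w = v ∧ X.ter w = v' ∧ X.SameSign (X.ini w) (X.ter w)),
          (1 : ℝ) / (X.b w)

/-- `A` has a nonpositive real eigenvalue. -/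
def HasNonposEigenvalue (A : Matrix V V ℝ) : Prop :=
  ∃ μ : ℝ, μ ≤ 0 ∧ ∃ x : V → ℝ, x ≠ 0 ∧ A.mulVec x = μ • x

/-- `A` has a negative real eigenvalue. -/
def HasNegEigenvalue (A : Matrix V V ℝ) : Prop :=
  ∃ μ : ℝ, μ < 0 ∧ ∃ x : V → ℝ, x ≠ 0 ∧ A.mulVec x = μ • x

/-- `A` is positive semidefinite: `(Ax,x) ≥ 0` for all `x`. -/
def PosSemidef' (A : Matrix V V ℝ) : Prop := ∀ x : V → ℝ, 0 ≤ x ⬝ᵥ A.mulVec x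

/-- `A` is singular: it has a nontrivial kernel. -/
def Singular (A : Matrix V V ℝ) : Prop := ∃ x : V → ℝ, x ≠ 0 ∧ A.mulVec x = 0

/-- `A` is supersingular: its kernel contains a vector with all coordinates nonzero. -/
def Supersingular (A : Matrix V V ℝ) : Prop :=
  ∃ x : V → ℝ, (∀ v, x v ≠ 0) ∧ A.mulVec x = 0

/-- `A` is weakly singular: there is a nonzero `x` with `(Ax)_v = 0` at every vertex of the
support of `x`. -/
def WeaklySingular (A : Matrix V V ℝ) : Prop :=
  ∃ x : V → ℝ, x ≠ 0 ∧ ∀ v, x v ≠ 0 → A.mulVec x v = 0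

end LabeledGraph

/-- The rational numbers as a subfield of the reals. -/
noncomputable abbrev ratSubfield : Subfield ℝ := (Rat.castHom ℝ).fieldRange

theorem mem_ratSubfield {x : ℝ} : x ∈ ratSubfield ↔ ∃ q : ℚ, x = q := by
  simp [RingHom.mem_fieldRange, eq_comm]

theorem dense_forall_mem_ratSubfield (ι : Type*) : Dense {x : ι → ℝ | ∀ i, x i ∈ ratSubfield} := by
  have h : Dense (Set.univ.pi fun _ : ι => (ratSubfield : Set ℝ)) :=
    dense_pi _ fun _ _ => by
      have := Rat.denseRange_cast (𝕜 := ℝ)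
      simpa [DenseRange, RingHom.coe_fieldRange] using this
  simpa [Set.pi] using h

theorem Rat.exists_sum_four_squares {r : ℚ} (hr : 0 ≤ r) :
    ∃ p : Fin 4 → ℚ, ∑ i, p i ^ 2 = r := by
  obtain ⟨a, b, c, d, h⟩ := Nat.sum_four_squares (r.num.toNat * r.den)
  have hden : (r.den : ℚ) ≠ 0 := by exact_mod_cast r.den_nz
  have hnum : ((r.num.toNat : ℕ) : ℚ) = r * r.den := by
    rw [Rat.mul_den_eq_num]
    exact_mod_cast Int.toNat_of_nonneg (Rat.num_nonneg.2 hr)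
  have h' : (a : ℚ) ^ 2 + b ^ 2 + c ^ 2 + d ^ 2 = r * r.den * r.den := by
    rw [← hnum]; exact_mod_cast h
  refine ⟨![a / r.den, b / r.den, c / r.den, d / r.den], ?_⟩
  simp only [Fin.sum_univ_four, Matrix.cons_val]
  field_simp
  linarith

/-- A real zero of a diagonal quadratic form is a limit of rational zeros as soon as some rational
zero is not orthogonal to it. The approximating points are reflections of the rational zero. -/
theorem mem_closure_rational_isotropic {ι : Type*} [Fintype ι] {d p a : ι → ℝ}
    (hd : ∀ i, d i ∈ ratSubfield) (hp : ∀ i, p i ∈ ratSubfield)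
    (hpp : ∑ i, d i * p i ^ 2 = 0) (ha : ∑ i, d i * a i ^ 2 = 0)
    (hpa : ∑ i, d i * (p i * a i) ≠ 0) :
    a ∈ closure {x : ι → ℝ | (∀ i, x i ∈ ratSubfield) ∧ ∑ i, d i * x i ^ 2 = 0} := by
  let F : (ι → ℝ) → ι → ℝ := fun e i =>
    p i - 2 * (∑ j, d j * (p j * e j)) / (∑ j, d j * e j ^ 2) * e i
  have hB : ∑ i, d i * (p i * (p - a) i) = -∑ i, d i * (p i * a i) := by
    rw [← sub_eq_zero, ← hpp, sub_neg_eq_add, ← sum_add_distrib]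
    exact sum_congr rfl fun i _ => by simp only [Pi.sub_apply]; ring
  have hq : ∑ i, d i * (p - a) i ^ 2 = -(2 * ∑ i, d i * (p i * a i)) := by
    have : ∑ i, d i * (p - a) i ^ 2 =
        ∑ i, d i * p i ^ 2 + ∑ i, d i * a i ^ 2 - 2 * ∑ i, d i * (p i * a i) := by
      rw [mul_sum, ← sum_add_distrib, ← sum_sub_distrib]
      exact sum_congr rfl fun i _ => by simp only [Pi.sub_apply]; ring
    rw [this, hpp, ha]; ring
  have hFa : F (p - a) = a := by
    funext i
    simp only [F]
    rw [hB, hq, mul_neg, neg_div_neg_eq, div_self (mul_ne_zero two_ne_zero hpa), one_mul,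
      Pi.sub_apply, sub_sub_cancel]
  have hF : Filter.Tendsto F (nhds (p - a)) (nhds a) := by
    have : ContinuousAt F (p - a) := by
      refine continuousAt_pi.2 fun i => ?_
      have h0 : ∑ j, d j * (p - a) j ^ 2 ≠ 0 := by
        rw [hq]; exact neg_ne_zero.2 (mul_ne_zero two_ne_zero hpa)
      have hnum : Continuous fun e : ι → ℝ => 2 * ∑ j, d j * (p j * e j) := by fun_prop
      have hden : Continuous fun e : ι → ℝ => ∑ j, d j * e j ^ 2 := by fun_prop
      exact continuousAt_const.sub
        ((hnum.continuousAt.div hden.continuousAt h0).mul (continuous_apply i).continuousAt)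
    simpa only [ContinuousAt, hFa] using this
  refine mem_closure_of_frequently_of_tendsto
    ((mem_closure_iff_frequently.1 (dense_forall_mem_ratSubfield ι (p - a))).mono
      fun e he => ⟨fun i => ?_, ?_⟩) hF
  · refine sub_mem (hp i) (mul_mem (div_mem (mul_mem (ofNat_mem _ 2) ?_) ?_) (he i))
    · exact sum_mem fun j _ => mul_mem (hd j) (mul_mem (hp j) (he j))
    · exact sum_mem fun j _ => mul_mem (hd j) (pow_mem (he j) 2)
  · have key : ∀ t : ℝ, ∑ i, d i * (p i - t * e i) ^ 2 =
        ∑ i, d i * p i ^ 2 - 2 * t * ∑ i, d i * (p i * e i) + t ^ 2 * ∑ i, d i * e i ^ 2 := by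
      intro t
      rw [mul_sum, mul_sum, ← sum_sub_distrib, ← sum_add_distrib]
      exact sum_congr rfl fun i _ => by ring
    simp only [F]
    rw [key, hpp]
    by_cases h0 : ∑ i, d i * e i ^ 2 = 0
    · simp [h0]
    · field_simp
      ring

/-- A positive zero of a rational diagonal quadratic form with four equal nonzero coefficients is a
limit of rational zeros. -/
theorem mem_closure_rational_isotropic_of_four_equal {ι : Type*} [Fintype ι] [DecidableEq ι]
    {d a : ι → ℝ} (hd : ∀ i, d i ∈ ratSubfield) (hpos : ∀ i, 0 < a i)
    (ha : ∑ i, d i * a i ^ 2 = 0) {S : Finset ι} (hS : S.card = 4) {c : ℝ} (hc : c ≠ 0)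
    (hSc : ∀ i ∈ S, d i = c) :
    a ∈ closure {x : ι → ℝ | (∀ i, x i ∈ ratSubfield) ∧ ∑ i, d i * x i ^ 2 = 0} := by
  obtain ⟨i₀, hi₀⟩ : S.Nonempty := card_pos.1 (by omega)
  have hcK : c ∈ ratSubfield := hSc i₀ hi₀ ▸ hd i₀
  let R : (ι → ℝ) → ℝ := fun x => -(∑ i ∈ Sᶜ, d i * x i ^ 2) / c
  have hSsum : ∀ x : ι → ℝ, ∑ i ∈ S, d i * x i ^ 2 = c * ∑ i ∈ S, x i ^ 2 := fun x => by
    rw [mul_sum]; exact sum_congr rfl fun i hi => by rw [hSc i hi]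
  have hRa : 0 < R a := by
    have h : R a = ∑ i ∈ S, a i ^ 2 := by
      rw [← sum_add_sum_compl S, hSsum] at ha
      simp only [R]
      field_simp
      linarith
    rw [h]
    exact sum_pos (fun i _ => pow_pos (hpos i) 2) ⟨i₀, hi₀⟩
  have hopen : IsOpen {x | 0 < R x} := isOpen_lt continuous_const (by fun_prop)
  obtain ⟨b, hbR, hb⟩ := (dense_forall_mem_ratSubfield ι).inter_open_nonempty _ hopen ⟨a, hRa⟩
  have hRb : R b ∈ ratSubfield :=
    div_mem (neg_mem (sum_mem fun i _ => mul_mem (hd i) (pow_mem (hb i) 2))) hcK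
  obtain ⟨r, hr⟩ := mem_ratSubfield.1 hRb
  have hr0 : 0 < r := by
    have : 0 < R b := hbR
    rw [hr] at this
    exact_mod_cast this
  obtain ⟨y, hy⟩ := Rat.exists_sum_four_squares hr0.le
  let σ : S ≃ Fin 4 := S.equivFinOfCardEq hS
  let p : ι → ℝ := fun i => if h : i ∈ S then (y (σ ⟨i, h⟩) : ℝ) else b i
  have hpS : ∑ i ∈ S, p i ^ 2 = R b := by
    rw [← sum_coe_sort, hr, ← hy, Rat.cast_sum, ← σ.sum_comp]
    exact sum_congr rfl fun i _ => by simp [p]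
  have hpp : ∑ i, d i * p i ^ 2 = 0 := by
    have h : ∑ i ∈ Sᶜ, d i * p i ^ 2 = ∑ i ∈ Sᶜ, d i * b i ^ 2 :=
      sum_congr rfl fun i hi => by simp [p, mem_compl.1 hi]
    rw [← sum_add_sum_compl S, hSsum, hpS, h]
    simp only [R]
    field_simp
    ring
  have hp : ∀ i, p i ∈ ratSubfield := fun i => by
    by_cases h : i ∈ S
    · exact mem_ratSubfield.2 ⟨_, by simp [p, h]; rfl⟩
    · simpa [p, h] using hb i
  obtain ⟨j, hjS, hj⟩ : ∃ j ∈ S, p j ^ 2 ≠ 0 :=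
    exists_ne_zero_of_sum_ne_zero (hpS ▸ ne_of_gt hbR)
  by_cases hpa : ∑ i, d i * (p i * a i) = 0
  · refine mem_closure_rational_isotropic (p := Function.update p j (-p j)) hd ?_ ?_ ha ?_
    · intro i
      by_cases h : i = j
      · subst h; simpa using hp i
      · simpa [h] using hp i
    · rw [← hpp]
      refine sum_congr rfl fun i _ => ?_
      by_cases h : i = j
      · subst h; simp
      · simp [h]
    · have h : ∑ i, d i * (Function.update p j (-p j) i * a i) =
          ∑ i, d i * (p i * a i) - 2 * (d j * (p j * a j)) := by
        rw [← add_sum_erase _ _ (mem_univ j), ← add_sum_erase univ (fun i => d i * (p i * a i))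
          (mem_univ j), sum_congr rfl fun i hi => by
            rw [Function.update_of_ne (ne_of_mem_erase hi)], Function.update_self]
        ring
      rw [h, hpa, zero_sub, hSc j hjS]
      have hj' : p j ≠ 0 := fun h => hj (by simp [h])
      exact neg_ne_zero.2 (mul_ne_zero two_ne_zero (mul_ne_zero hc (mul_ne_zero hj' (hpos j).ne')))
  · exact mem_closure_rational_isotropic hd hp hpp ha hpa

namespace LabeledGraph

variable {V W : Type} [Fintype V] [DecidableEq V] [Fintype W] [DecidableEq W]

/-- The sum of an edge function over the oriented edges issuing from a vertex. -/
def outSum (X : LabeledGraph V W) : (W → ℝ) →ₗ[ℝ] V → ℝ where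
  toFun x v := ∑ w ∈ univ.filter (fun w => X.ini w = v), x w
  map_add' x y := funext fun v => by simp [sum_add_distrib]
  map_smul' c x := funext fun v => by simp [mul_sum]

theorem outSum_apply (X : LabeledGraph V W) (x : W → ℝ) (v : V) :
    X.outSum x v = ∑ w ∈ univ.filter (fun w => X.ini w = v), x w := rfl

theorem ter_rev (X : LabeledGraph V W) (w : W) : X.ter (X.rev w) = X.ini w := by
  rw [ter, X.rev_invol]

theorem sum_mul_outSum (X : LabeledGraph V W) (c : V → ℝ) (x : W → ℝ) :
    ∑ v, c v * X.outSum x v = ∑ w, c (X.ini w) * x w := by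
  simp only [outSum_apply, mul_sum]
  rw [← sum_fiberwise univ X.ini]
  exact sum_congr rfl fun v _ => sum_congr rfl fun w hw => by rw [(mem_filter.1 hw).2]

/-- For a function alternating along edges, the alternating total of the vertex sums of a
symmetric edge function vanishes. -/
theorem sum_mul_outSum_eq_zero (X : LabeledGraph V W) {c : V → ℝ}
    (hc : ∀ w, c (X.ter w) = -c (X.ini w)) {x : W → ℝ} (hx : ∀ w, x (X.rev w) = x w) :
    ∑ v, c v * X.outSum x v = 0 := by
  have h : ∑ w, c (X.ini w) * x w = ∑ w, c (X.ini (X.rev w)) * x (X.rev w) :=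
    (Equiv.sum_comp (Function.Involutive.toPerm X.rev X.rev_invol) fun w => c (X.ini w) * x w).symm
  have h' : ∑ w, c (X.ini (X.rev w)) * x (X.rev w) = -∑ w, c (X.ini w) * x w := by
    rw [← sum_neg_distrib]
    refine sum_congr rfl fun w _ => ?_
    have := hc w
    rw [ter] at this
    rw [this, hx, neg_mul]
  rw [sum_mul_outSum]
  linarith

/-- `y` is the family of vertex sums of a rational symmetric edge function. -/
def RatOutSum (X : LabeledGraph V W) (y : V → ℝ) : Prop :=
  ∃ z : W → ℝ, (∀ w, z w ∈ ratSubfield) ∧ (∀ w, z (X.rev w) = z w) ∧ X.outSum z = y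

theorem RatOutSum.sub {X : LabeledGraph V W} {y y' : V → ℝ} (h : X.RatOutSum y)
    (h' : X.RatOutSum y') : X.RatOutSum (y - y') := by
  obtain ⟨z, hz, hzs, rfl⟩ := h
  obtain ⟨z', hz', hzs', rfl⟩ := h'
  exact ⟨z - z', fun w => sub_mem (hz w) (hz' w), fun w => by simp [hzs, hzs'], map_sub _ _ _⟩

theorem RatOutSum.smul {X : LabeledGraph V W} {y : V → ℝ} (h : X.RatOutSum y) {c : ℝ}
    (hc : c ∈ ratSubfield) : X.RatOutSum (c • y) := by
  obtain ⟨z, hz, hzs, rfl⟩ := h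
  exact ⟨c • z, fun w => mul_mem hc (hz w), fun w => by simp [hzs], map_smul _ _ _⟩

theorem ratOutSum_zero (X : LabeledGraph V W) : X.RatOutSum 0 :=
  ⟨0, fun _ => zero_mem _, fun _ => rfl, map_zero _⟩

theorem ratOutSum_edge (X : LabeledGraph V W) (w : W) :
    X.RatOutSum (Pi.single (X.ini w) 1 + Pi.single (X.ter w) 1) := by
  refine ⟨Pi.single w 1 + Pi.single (X.rev w) 1, fun u => ?_, fun u => ?_, ?_⟩
  · refine add_mem ?_ ?_ <;> rw [Pi.single_apply] <;> split_ifs <;>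
      first | exact one_mem _ | exact zero_mem _
  · have h : X.rev u = w ↔ u = X.rev w :=
      ⟨fun h => by rw [← h, X.rev_invol], fun h => by rw [h, X.rev_invol]⟩
    have h' : X.rev u = X.rev w ↔ u = w :=
      (show Function.Involutive X.rev from X.rev_invol).injective.eq_iff
    simp only [Pi.add_apply, Pi.single_apply, h, h']
    ring
  · funext v
    simp only [outSum_apply, Pi.add_apply, sum_add_distrib, Pi.single_apply, sum_ite_eq',
      mem_filter, mem_univ, true_and, ter]
    simp only [eq_comm]

/-- Either every vertex indicator is a rational symmetric vertex sum, or the graph is bipartite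
and this holds up to a correction at one base vertex. In both cases the correction is measured by
a function `c`. -/
theorem exists_ratOutSum_single_sub (X : LabeledGraph V W) :
    ∃ (r : V) (c : V → ℝ),
      (∀ v, X.RatOutSum (Pi.single v 1 - c v • Pi.single r 1)) ∧
      (∀ w, c (X.ter w) = -c (X.ini w)) ∧
      (c = 0 ∨ ∃ f : V → Bool, (∀ w, f (X.ini w) ≠ f (X.ter w)) ∧
        ∀ v, c v = if f v then 1 else -1) := by
  classical
  obtain ⟨w₀⟩ := X.edges_nonempty
  let r := X.ini w₀
  let P : ℝ → V → Prop := fun s v => X.RatOutSum (Pi.single v 1 - s • Pi.single r 1)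
  have step : ∀ s w, P s (X.ini w) → P (-s) (X.ter w) := fun s w h => by
    have := (X.ratOutSum_edge w).sub h
    convert this using 1
    module
  have reach : ∀ v, P 1 v ∨ P (-1) v := fun v => by
    induction X.connected r v with
    | refl => exact Or.inl (by simpa [P] using X.ratOutSum_zero)
    | tail _ h ih =>
      obtain ⟨w, rfl, rfl⟩ := h
      rcases ih with h | h
      · exact Or.inr (step _ w h)
      · exact Or.inl (by simpa [ter] using step _ w h)
  by_cases hboth : ∃ v, P 1 v ∧ P (-1) v
  · obtain ⟨v₀, h₁, h₂⟩ := hboth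
    have half : (2⁻¹ : ℝ) ∈ ratSubfield := inv_mem (ofNat_mem _ 2)
    have hr : X.RatOutSum (Pi.single r 1) := by
      convert (h₂.sub h₁).smul half using 1
      module
    refine ⟨r, 0, fun v => ?_, fun w => by simp, Or.inl rfl⟩
    rcases reach v with h | h
    · convert h.sub (hr.smul (neg_mem (one_mem ratSubfield))) using 1
      simp
    · convert h.sub hr using 1
      simp
  · push Not at hboth
    have hflip : ∀ w, P 1 (X.ter w) ↔ ¬ P 1 (X.ini w) := fun w => by
      constructor
      · exact fun h h' => hboth _ h (step _ w h')
      · exact fun h => by simpa using step _ w ((reach _).resolve_left h)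
    refine ⟨r, fun v => if P 1 v then 1 else -1, fun v => ?_, fun w => ?_,
      Or.inr ⟨fun v => decide (P 1 v), fun w => ?_, fun v => by simp⟩⟩
    · beta_reduce
      split_ifs with h
      · exact h
      · exact (reach v).resolve_left h
    · by_cases h : P 1 (X.ini w) <;> simp [hflip, h]
    · by_cases h : P 1 (X.ini w) <;> simp [hflip, h]

end LabeledGraph

open LabeledGraph in
/-- Rational approximation of NPC-solutions: if all charges of `X` are rational and, in
case the underlying graph is bipartite, for every bipartition one of the parts contains
four distinct vertices with equal nonzero charges, then every NPC-solution of the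
BKN-equation over `X` can be approximated by rational NPC-solutions. -/
theorem npc_solution_rational_approximation
    {V W : Type} [Fintype V] [DecidableEq V] [Fintype W] [DecidableEq W]
    (X : LabeledGraph V W)
    (hk : ∀ v, ∃ q : ℚ, X.k v = q)
    (hbip : ∀ f : V → Bool, (∀ w : W, f (X.ini w) ≠ f (X.ter w)) →
      ∃ (p : Bool) (S : Finset V), S.card = 4 ∧ (∀ v ∈ S, f v = p) ∧
        ∃ c : ℝ, c ≠ 0 ∧ ∀ v ∈ S, X.k v = c)
    (a : V → ℝ) (γ : W → ℝ) (hnpc : X.NPCSolution a γ) :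
    ∀ ε > (0 : ℝ), ∃ (a' : V → ℝ) (γ' : W → ℝ),
      X.NPCSolution a' γ' ∧
      (∀ v, ∃ q : ℚ, a' v = q) ∧ (∀ w, ∃ q : ℚ, γ' w = q) ∧
      (∀ v, |a' v - a v| < ε) ∧ ∀ w, |γ' w - γ w| < ε := by
  intro ε hε
  obtain ⟨hBKN, -, hsym, hpos, hlt⟩ := hnpc
  have hkK : ∀ v, X.k v ∈ ratSubfield := fun v => mem_ratSubfield.2 (hk v)
  obtain ⟨r, c, hz, hc, hc'⟩ := X.exists_ratOutSum_single_sub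
  choose z hzK hzs hzsum using hz
  have hcK : ∀ v, c v ∈ ratSubfield := fun v => by
    rcases hc' with rfl | ⟨f, -, hf⟩
    · exact zero_mem _
    · rw [hf]
      split_ifs
      · exact one_mem _
      · exact neg_mem (one_mem _)
  have hb : ∀ w, (X.b w : ℝ) ≠ 0 := fun w => Nat.cast_ne_zero.2 (ne_of_gt (X.b_pos w))
  -- The equation is linear in the products `x w` below.
  let x : W → ℝ := fun w => γ w / X.b w * (a (X.ini w) * a (X.ter w))
  have hxs : ∀ w, x (X.rev w) = x w := fun w => by
    simp only [x]
    rw [hsym, X.b_symm, X.ter_rev, mul_comm (a (X.ini w)), ter]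
  have hxsum : ∀ v, X.outSum x v = X.k v * a v ^ 2 := fun v => by
    rw [outSum_apply, pow_two, ← mul_assoc, hBKN v, sum_mul]
    exact sum_congr rfl fun w hw => by rw [← (mem_filter.1 hw).2]; ring
  have ha0 : ∑ v, c v * X.k v * a v ^ 2 = 0 := by
    rw [← X.sum_mul_outSum_eq_zero hc hxs]
    exact sum_congr rfl fun v _ => by rw [hxsum]; ring
  have hacl : a ∈ closure {y : V → ℝ | (∀ v, y v ∈ ratSubfield) ∧
      ∑ v, c v * X.k v * y v ^ 2 = 0} := by
    rcases hc' with rfl | ⟨f, hf, hcf⟩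
    · simpa using dense_forall_mem_ratSubfield V a
    · obtain ⟨p, S, hS, hfS, κ, hκ, hkS⟩ := hbip f hf
      refine mem_closure_rational_isotropic_of_four_equal (d := fun v => c v * X.k v)
        (fun v => mul_mem (hcK v) (hkK v)) hpos ha0 hS (c := (if p then 1 else -1) * κ)
        (mul_ne_zero (by split_ifs <;> norm_num) hκ) fun v hv => ?_
      simp only [hcf, hfS v hv, hkS v hv]
  let sy : (W → ℝ) → W → ℝ := fun t w => (t w + t (X.rev w)) / 2
  let Φ : (V → ℝ) × (W → ℝ) → W → ℝ := fun q w =>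
    sy q.2 w + ∑ v, (X.k v * q.1 v ^ 2 - X.outSum (sy q.2) v) * z v w
  let Γ : (V → ℝ) × (W → ℝ) → W → ℝ := fun q w =>
    Φ q w * X.b w / (q.1 (X.ini w) * q.1 (X.ter w))
  have hsys : ∀ t w, sy t (X.rev w) = sy t w := fun t w => by
    simp only [sy, X.rev_invol, add_comm]
  have hsyx : sy x = x := funext fun w => by simp [sy, hxs]
  have hΦx : Φ (a, x) = x := funext fun w => by simp [Φ, hsyx, hxsum]
  have hΓx : Γ (a, x) = γ := funext fun w => by
    have h₁ := (hpos (X.ini w)).ne'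
    have h₂ := (hpos (X.ter w)).ne'
    have h₃ := hb w
    simp only [Γ, hΦx, x]
    field_simp
  have hΓc : ∀ w, ContinuousAt (fun q => Γ q w) (a, x) := fun w => by
    have h : a (X.ini w) * a (X.ter w) ≠ 0 := (mul_pos (hpos _) (hpos _)).ne'
    simp only [Γ, Φ, sy, outSum_apply]
    fun_prop (disch := exact h)
  have hfst : ∀ v, ContinuousAt (fun q : (V → ℝ) × (W → ℝ) => q.1 v) (a, x) := fun v => by
    fun_prop
  have hgood : ∀ᶠ q in nhds (a, x), (∀ v, 0 < q.1 v) ∧ (∀ v, |q.1 v - a v| < ε) ∧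
      (∀ w, |Γ q w| < 1) ∧ ∀ w, |Γ q w - γ w| < ε := by
    refine (Filter.eventually_all.2 fun v => ?_).and ((Filter.eventually_all.2 fun v => ?_).and
      ((Filter.eventually_all.2 fun w => ?_).and (Filter.eventually_all.2 fun w => ?_)))
    · exact (hfst v).eventually_const_lt (hpos v)
    · exact ((hfst v).sub continuousAt_const).abs.eventually_lt_const (by simpa using hε)
    · exact (hΓc w).abs.eventually_lt_const (by simpa only [hΓx] using hlt w)
    · exact ((hΓc w).sub continuousAt_const).abs.eventually_lt_const (by simpa [hΓx] using hε)
  have hcl : (a, x) ∈ closure ({y : V → ℝ | (∀ v, y v ∈ ratSubfield) ∧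
      ∑ v, c v * X.k v * y v ^ 2 = 0} ×ˢ {t : W → ℝ | ∀ w, t w ∈ ratSubfield}) := by
    rw [closure_prod_eq]
    exact ⟨hacl, dense_forall_mem_ratSubfield W x⟩
  obtain ⟨q, ⟨⟨hqK, hq0⟩, htK⟩, hqpos, hqa, hqlt, hqγ⟩ :=
    ((mem_closure_iff_frequently.1 hcl).and_eventually hgood).exists
  have hsyK : ∀ w, sy q.2 w ∈ ratSubfield := fun w =>
    div_mem (add_mem (htK _) (htK _)) (ofNat_mem _ 2)
  have hΦK : ∀ w, Φ q w ∈ ratSubfield := fun w =>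
    add_mem (hsyK w) (sum_mem fun v _ => mul_mem (sub_mem (mul_mem (hkK v) (pow_mem (hqK v) 2))
      (sum_mem fun u _ => hsyK u)) (hzK v w))
  have hΓK : ∀ w, Γ q w ∈ ratSubfield := fun w =>
    div_mem (mul_mem (hΦK w) (natCast_mem _ _)) (mul_mem (hqK _) (hqK _))
  have hΓs : X.SymSol (Γ q) := fun w => by
    simp only [Γ, Φ, hsys, hzs, X.b_symm, X.ter_rev]
    rw [mul_comm (q.1 (X.ini w)), ter]
  have hΦsum : ∀ v, X.outSum (Φ q) v = X.k v * q.1 v ^ 2 := by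
    let e : V → ℝ := fun v => X.k v * q.1 v ^ 2 - X.outSum (sy q.2) v
    have he : ∑ v, e v * c v = 0 := by
      have h := X.sum_mul_outSum_eq_zero hc (hsys q.2)
      calc ∑ v, e v * c v
          = ∑ v, c v * X.k v * q.1 v ^ 2 - ∑ v, c v * X.outSum (sy q.2) v := by
            rw [← sum_sub_distrib]
            exact sum_congr rfl fun v _ => by simp only [e]; ring
        _ = 0 := by rw [hq0, h, sub_zero]
    have hΦ : Φ q = sy q.2 + ∑ v, e v • z v := funext fun w => by simp [Φ, e]
    have hsum : ∑ v, e v • (Pi.single v 1 - c v • Pi.single r 1 : V → ℝ) = e := by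
      simp only [smul_sub, smul_smul, sum_sub_distrib, ← sum_smul, he, zero_smul, sub_zero]
      funext u
      simp [Pi.single_apply]
    intro v
    rw [hΦ, map_add, map_sum]
    simp only [map_smul, hzsum, hsum]
    simp [e]
  have hne : ∀ v, q.1 v ≠ 0 := fun v => (hqpos v).ne'
  refine ⟨q.1, Γ q, ⟨fun v => ?_, ⟨fun v => (hqpos v).le, fun h => ?_, fun w => (hqlt w).le,
    fun w _ => hΓs w, fun v hv => absurd hv (hne v)⟩, hΓs, hqpos, hqlt⟩,
    fun v => mem_ratSubfield.1 (hqK v), fun w => mem_ratSubfield.1 (hΓK w), hqa, hqγ⟩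
  · have h : ∑ w ∈ univ.filter (fun w => X.ini w = v), Γ q w / (X.b w : ℝ) * q.1 (X.ter w) =
        X.outSum (Φ q) v / q.1 v := by
      rw [outSum_apply, sum_div]
      refine sum_congr rfl fun w hw => ?_
      rw [← (mem_filter.1 hw).2]
      have h₁ := hne (X.ini w)
      have h₂ := hne (X.ter w)
      have h₃ := hb w
      simp only [Γ]
      field_simp
    have hv := hne v
    rw [h, hΦsum]
    field_simp
  · obtain ⟨w⟩ := X.edges_nonempty
    exact hne (X.ini w) (congrFun h _)
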